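/- Let G be a directed graph and x_k a vertex that lies on no directed cycle of G. Let G^(k) be the graph obtained by removing all incoming and outgoing edges of x_k. Then minrank_2(G^(k)) = minrank_2(G), i.e., all edges incident to x_k are minrank-non-critical. -/

import Mathlib

/-- A matrix `A` fits a directed graph with edge relation `E` if it has 1's on the
diagonal and 0's at off-diagonal non-edges. -/
def Fits {V : Type*} {F : Type*} [Field F] (E : V → V → Prop)
    (A : Matrix V V F) : Prop :=
  (∀ v, A v v = 1) ∧ ∀ u v, u ≠ v → ¬ E u v → A u v = 0

/-- The minrank over `F` of the directed graph with edge relation `E`. -/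
noncomputable def minrank (F : Type*) [Field F] {V : Type*} [Fintype V]
    (E : V → V → Prop) : ℕ :=
  sInf {r | ∃ A : Matrix V V F, Fits E A ∧ A.rank = r}

/-- Vertex `k` lies on a directed cycle (on at least two distinct vertices). -/
def OnCycle {V : Type*} (E : V → V → Prop) (k : V) : Prop :=
  ∃ (n : ℕ) (f : Fin (n + 2) → V), Function.Injective f ∧ f 0 = k ∧
    (∀ i : Fin (n + 1), E (f i.castSucc) (f i.succ)) ∧ E (f (Fin.last (n + 1))) (f 0)

/-- `v` is reachable from `k` by a simple path. -/
def SReach {V : Type*} (E : V → V → Prop) (k v : V) : Prop :=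
  ∃ (n : ℕ) (f : ℕ → V), f 0 = k ∧ f n = v ∧ (∀ i < n, E (f i) (f (i + 1))) ∧
    ∀ i ≤ n, ∀ j ≤ n, f i = f j → i = j

lemma SReach.refl {V : Type*} (E : V → V → Prop) (k : V) : SReach E k k :=
  ⟨0, fun _ => k, rfl, rfl, by simp, by intro i hi j hj _; omega⟩

lemma SReach.step {V : Type*} {E : V → V → Prop} {k u v : V} (h : SReach E k u)
    (huv : E u v) : SReach E k v := by
  classical
  obtain ⟨n, f, h0, hn, he, hi⟩ := h
  by_cases hv : ∃ j ≤ n, f j = v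
  · obtain ⟨j, hj, rfl⟩ := hv
    exact ⟨j, f, h0, rfl, fun i h => he i (by omega),
      fun a ha b hb => hi a (by omega) b (by omega)⟩
  · push Not at hv
    refine ⟨n + 1, fun i => if i ≤ n then f i else v, by simpa using h0, by simp, ?_, ?_⟩
    · intro i hin
      rcases Nat.lt_or_ge i n with h | h
      · have h1 : i ≤ n := by omega
        have h2 : i + 1 ≤ n := by omega
        simpa [h1, h2] using he i h
      · have : i = n := by omega
        subst this
        simpa [hn] using huv
    · intro a ha b hb hab
      by_cases h1 : a ≤ n <;> by_cases h2 : b ≤ n <;> simp only [h1, h2, if_true, if_false] at hab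
      · exact hi a h1 b h2 hab
      · exact absurd hab (hv a h1)
      · exact absurd hab.symm (hv b h2)
      · omega

lemma SReach.onCycle {V : Type*} {E : V → V → Prop} {k u : V} (h : SReach E k u)
    (hu : u ≠ k) (huk : E u k) : OnCycle E k := by
  obtain ⟨n, f, h0, hn, he, hi⟩ := h
  obtain _ | m := n
  · exact absurd (hn.symm.trans h0) hu
  · refine ⟨m, fun i => f i.val, ?_, by simpa using h0, ?_, ?_⟩
    · intro a b hab
      exact Fin.ext (hi a (by omega) b (by omega) hab)
    · intro i
      simpa using he i i.2
    · simpa [hn, h0] using huk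

lemma rank_add_le' {V F : Type*} [Fintype V] [Field F] (A B : Matrix V V F) :
    (A + B).rank ≤ A.rank + B.rank := by
  unfold Matrix.rank
  refine le_trans (Submodule.finrank_mono ?_)
    (Submodule.finrank_add_le_finrank_add_finrank _ _)
  rintro _ ⟨x, rfl⟩
  rw [Matrix.mulVecLin_add, LinearMap.add_apply]
  exact Submodule.add_mem_sup ⟨x, rfl⟩ ⟨x, rfl⟩

lemma rank_triangular {V F : Type*} [Fintype V] [Field F] (A : Matrix V V F)
    (p : V → Prop) [DecidablePred p] (h : ∀ i j, ¬ p i → p j → A i j = 0) :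
    (Matrix.of fun i j => if (p i ↔ p j) then A i j else 0 : Matrix V V F).rank ≤ A.rank := by
  classical
  set P : Matrix V V F := Matrix.diagonal fun i => if p i then 1 else 0 with hP
  set Q : Matrix V V F := Matrix.diagonal fun i => if p i then 0 else 1 with hQ
  have e : (Matrix.of fun i j => if (p i ↔ p j) then A i j else 0 : Matrix V V F)
      = A * P + Q * A := by
    ext i j
    simp only [hP, hQ, Matrix.add_apply, Matrix.mul_diagonal, Matrix.diagonal_mul, Matrix.of_apply]
    have := h i j
    by_cases h1 : p i <;> by_cases h2 : p j <;> simp_all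
  have z : Q * (A * P) = 0 := by
    ext i j
    simp only [hP, hQ, Matrix.mul_diagonal, Matrix.diagonal_mul, Matrix.zero_apply]
    have := h i j
    by_cases h1 : p i <;> by_cases h2 : p j <;> simp_all
  rw [e]
  refine (rank_add_le' _ _).trans ?_
  let W := LinearMap.range A.mulVecLin
  let g := Q.mulVecLin.domRestrict W
  have hg := g.finrank_range_add_finrank_ker
  have h1 : (Q * A).rank ≤ Module.finrank F (LinearMap.range g) := by
    refine Submodule.finrank_mono ?_
    rintro _ ⟨x, rfl⟩
    exact ⟨⟨A.mulVecLin x, x, rfl⟩, by simp [g]⟩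
  have h2 : (A * P).rank ≤ Module.finrank F (LinearMap.ker g) := by
    rw [← Submodule.finrank_map_subtype_eq]
    refine Submodule.finrank_mono ?_
    rintro _ ⟨x, rfl⟩
    refine ⟨⟨(A * P).mulVecLin x, P.mulVecLin x, by simp⟩, ?_, rfl⟩
    change Q.mulVec ((A * P).mulVec x) = 0
    rw [Matrix.mulVec_mulVec, z, Matrix.zero_mulVec]
  have h3 : A.rank = Module.finrank F W := rfl
  omega

theorem minrank_noncritical_edges_of_acyclic_vertex {V : Type*} [Fintype V]
    (E : V → V → Prop) (k : V) (hk : ¬ OnCycle E k) :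
    minrank (ZMod 2) (fun u v => E u v ∧ u ≠ k ∧ v ≠ k) = minrank (ZMod 2) E := by
  classical
  apply le_antisymm
  · have hne : {r | ∃ A : Matrix V V (ZMod 2), Fits E A ∧ A.rank = r}.Nonempty :=
      ⟨_, 1, ⟨fun v => Matrix.one_apply_eq v, fun u v h _ => Matrix.one_apply_ne h⟩, rfl⟩
    obtain ⟨A, ⟨hd, hA⟩, hr⟩ := Nat.sInf_mem hne
    have hr' : A.rank = minrank (ZMod 2) E := hr
    rw [← hr']
    have t1 := rank_triangular A (fun v => ¬ SReach E k v) (by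
      intro i j hi hj
      rw [not_not] at hi
      exact hA i j (fun e => hj (e ▸ hi)) (fun e => hj (hi.step e)))
    set B : Matrix V V (ZMod 2) :=
      Matrix.of fun i j => if (¬ SReach E k i ↔ ¬ SReach E k j) then A i j else 0 with hB
    have t2 := rank_triangular B (fun v => ¬ SReach E k v ∨ v = k) (by
      intro i j hi hj
      push Not at hi
      obtain ⟨hi, hik⟩ := hi
      rcases hj with hj | rfl
      · simp [hB, hi, hj]
      · have : A i j = 0 := hA i j hik (fun e => hk (hi.onCycle hik e))
        simp [hB, this])
    refine le_trans (Nat.sInf_le ⟨_, ⟨?_, ?_⟩, rfl⟩) (t2.trans t1)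
    · intro v
      simp [hB, hd]
    · intro u v huv he
      have hkk := SReach.refl E k
      by_cases hu : u = k
      · subst hu
        have hvk : v ≠ u := Ne.symm huv
        by_cases hv : SReach E u v <;> simp [hB, hkk, hv, hvk]
      · by_cases hv : v = k
        · subst hv
          by_cases hv : SReach E v u <;> simp [hB, hkk, hv, hu]
        · have : A u v = 0 := hA u v huv (fun e => he ⟨e, hu, hv⟩)
          simp [hB, this]
  · have hne : {r | ∃ A : Matrix V V (ZMod 2),
        Fits (fun u v => E u v ∧ u ≠ k ∧ v ≠ k) A ∧ A.rank = r}.Nonempty :=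
      ⟨_, 1, ⟨fun v => Matrix.one_apply_eq v, fun u v h _ => Matrix.one_apply_ne h⟩, rfl⟩
    obtain ⟨A, ⟨hd, hA⟩, hr⟩ := Nat.sInf_mem hne
    exact Nat.sInf_le ⟨A, ⟨hd, fun u v h e => hA u v h (fun h' => e h'.1)⟩, hr⟩
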